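/- Let t_1, t_2, t_3, t_4 be integers with 0 ≤ t_i ≤ 2, and let G = C_4(t_1,t_2,t_3,t_4) be the graph obtained from a 4-cycle by attaching, at its i-th vertex, a pendant path with t_i edges (for i = 1,…,4). Then the second largest eigenvalue of G is at most √2 and the second smallest eigenvalue of G is at least −√2; moreover λ_2(G) = −λ_2^-(G). -/

import Mathlib

open Polynomial in
/-- `μ` is the sequence of adjacency eigenvalues of `G`, listed with multiplicity
in decreasing order (so `μ ⟨i-1,_⟩` is the `i`-th largest eigenvalue `λ_i`). -/
def SimpleGraph.IsEigenvalueSeq {V : Type*} [Fintype V] [DecidableEq V]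
    (G : SimpleGraph V) (μ : Fin (Fintype.card V) → ℝ) : Prop :=
  Antitone μ ∧
    (letI : DecidableRel G.Adj := Classical.decRel _
     (SimpleGraph.adjMatrix ℝ G).charpoly) =
      ∏ i : Fin (Fintype.card V), (X - C (μ i))

/-- The graph `C₄(t₀,t₁,t₂,t₃)`, obtained from a 4-cycle (on the vertices `Sum.inl i`,
`i : Fin 4`) by attaching at its `i`-th vertex a pendant path with `t i` edges (whose
vertices are `Sum.inr ⟨i, j⟩`, `j : Fin (t i)`). -/
def cycleFourPendant (t : Fin 4 → ℕ) :
    SimpleGraph ((Fin 4) ⊕ (Σ i : Fin 4, Fin (t i))) :=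
  SimpleGraph.fromRel (fun x y =>
    match x, y with
    | Sum.inl i, Sum.inl j => j = i + 1
    | Sum.inl i, Sum.inr ⟨i', j⟩ => i = i' ∧ (j : ℕ) = 0
    | Sum.inr ⟨i, j⟩, Sum.inr ⟨i', j'⟩ => i = i' ∧ (j' : ℕ) = (j : ℕ) + 1
    | _, _ => False)


lemma path_form (n : ℕ) (hn : n ≤ 2) (y : ℝ) (w : Fin n → ℝ) :
    2 * ∑ j : Fin n, (if (j : ℕ) = 0 then y * w j else 0)
      + ∑ j : Fin n, ∑ j' : Fin n, (if ((j' : ℕ) = j + 1 ∨ (j : ℕ) = j' + 1) then w j * w j' else 0)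
    ≤ Real.sqrt 2 * (y ^ 2 + ∑ j, w j ^ 2) := by
  have hs : Real.sqrt 2 ^ 2 = 2 := Real.sq_sqrt (by norm_num)
  have hp : 0 < Real.sqrt 2 := by positivity
  generalize Real.sqrt 2 = s at *
  interval_cases n
  · simp; positivity
  · simp
    have : 0 ≤ s * ((w 0 - s / 2 * y) ^ 2 + y ^ 2 / 2) := by positivity
    nlinarith
  · simp [Fin.sum_univ_two]
    have : 0 ≤ s * (w 1 - s / 2 * w 0) ^ 2 + s / 2 * (w 0 - s * y) ^ 2 := by positivity
    nlinarith

lemma adj11 (t : Fin 4 → ℕ) (i i' : Fin 4) :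
    (cycleFourPendant t).Adj (Sum.inl i) (Sum.inl i') ↔ (i' = i + 1 ∨ i = i' + 1) := by
  simp only [cycleFourPendant, SimpleGraph.fromRel_adj, ne_eq, Sum.inl.injEq]
  revert i i'; decide

lemma adj12 (t : Fin 4 → ℕ) (i i' : Fin 4) (j : Fin (t i')) :
    (cycleFourPendant t).Adj (Sum.inl i) (Sum.inr ⟨i', j⟩) ↔ (i = i' ∧ (j : ℕ) = 0) := by
  simp [cycleFourPendant, SimpleGraph.fromRel_adj]

lemma adj21 (t : Fin 4 → ℕ) (i i' : Fin 4) (j : Fin (t i')) :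
    (cycleFourPendant t).Adj (Sum.inr ⟨i', j⟩) (Sum.inl i) ↔ (i = i' ∧ (j : ℕ) = 0) := by
  rw [SimpleGraph.adj_comm, adj12]

lemma adj22 (t : Fin 4 → ℕ) (i i' : Fin 4) (j : Fin (t i)) (j' : Fin (t i')) :
    (cycleFourPendant t).Adj (Sum.inr ⟨i, j⟩) (Sum.inr ⟨i', j'⟩) ↔
      (i = i' ∧ ((j' : ℕ) = j + 1 ∨ (j : ℕ) = j' + 1)) := by
  simp only [cycleFourPendant, SimpleGraph.fromRel_adj, ne_eq, Sum.inr.injEq]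
  constructor
  · rintro ⟨_, h | h⟩
    · exact ⟨h.1, .inl h.2⟩
    · exact ⟨h.1.symm, .inr h.2⟩
  · rintro ⟨rfl, h⟩
    refine ⟨?_, h.imp (⟨rfl, ·⟩) (⟨rfl, ·⟩)⟩
    intro h'
    simp only [Sigma.mk.injEq, heq_eq_eq, true_and] at h'
    subst h'
    omega

lemma quad_form (t : Fin 4 → ℕ) (ht : ∀ i, t i ≤ 2) [DecidableRel (cycleFourPendant t).Adj]
    (x : (Fin 4) ⊕ (Σ i : Fin 4, Fin (t i)) → ℝ) (hx : x (Sum.inl 0) + x (Sum.inl 2) = 0) :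
    x ⬝ᵥ ((cycleFourPendant t).adjMatrix ℝ).mulVec x ≤ Real.sqrt 2 * (x ⬝ᵥ x) := by
  have h11 : ∀ i i' : Fin 4, (cycleFourPendant t).adjMatrix ℝ (Sum.inl i) (Sum.inl i') =
      if (i' = i + 1 ∨ i = i' + 1) then 1 else 0 := by
    intro i i'
    simp only [SimpleGraph.adjMatrix_apply, adj11]
  have h12 : ∀ i i' j, (cycleFourPendant t).adjMatrix ℝ (Sum.inl i) (Sum.inr ⟨i', j⟩) =
      if (i = i' ∧ (j : ℕ) = 0) then 1 else 0 := by
    intro i i' j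
    simp only [SimpleGraph.adjMatrix_apply, adj12]
  have h21 : ∀ i i' j, (cycleFourPendant t).adjMatrix ℝ (Sum.inr ⟨i', j⟩) (Sum.inl i) =
      if (i = i' ∧ (j : ℕ) = 0) then 1 else 0 := by
    intro i i' j
    simp only [SimpleGraph.adjMatrix_apply, adj21]
  have h22 : ∀ i i' j j', (cycleFourPendant t).adjMatrix ℝ (Sum.inr ⟨i, j⟩) (Sum.inr ⟨i', j'⟩) =
      if i = i' then (if ((j' : ℕ) = j + 1 ∨ (j : ℕ) = j' + 1) then 1 else 0) else 0 := by
    intro i i' j j'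
    simp only [SimpleGraph.adjMatrix_apply, adj22, ite_and]
  have hp := fun i => path_form (t i) (ht i) (x (Sum.inl i)) (fun j => x (Sum.inr ⟨i, j⟩))
  have e1 : x ⬝ᵥ ((cycleFourPendant t).adjMatrix ℝ).mulVec x =
      2 * (x (Sum.inl 0) + x (Sum.inl 2)) * (x (Sum.inl 1) + x (Sum.inl 3)) +
      ∑ i, (2 * ∑ j : Fin (t i), (if (j : ℕ) = 0 then x (Sum.inl i) * x (Sum.inr ⟨i, j⟩) else 0)
      + ∑ j : Fin (t i), ∑ j' : Fin (t i), (if ((j' : ℕ) = j + 1 ∨ (j : ℕ) = j' + 1) then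
          x (Sum.inr ⟨i, j⟩) * x (Sum.inr ⟨i, j'⟩) else 0)) := by
    simp only [dotProduct, Matrix.mulVec, Fintype.sum_sum_type, Fintype.sum_sigma, h11, h12, h21, h22]
    have k12 : ∀ i : Fin 4, ∑ i' : Fin 4, ∑ j : Fin (t i'),
        (if i = i' ∧ (j : ℕ) = 0 then (1:ℝ) else 0) * x (Sum.inr ⟨i', j⟩) =
        ∑ j : Fin (t i), if (j : ℕ) = 0 then x (Sum.inr ⟨i, j⟩) else 0 := by
      intro i
      rw [Finset.sum_eq_single i]
      · simp
      · intro b _ hb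
        simp [hb.symm]
      · simp
    have k21 : ∀ (i : Fin 4) (j : Fin (t i)), ∑ i' : Fin 4,
        (if i' = i ∧ (j : ℕ) = 0 then (1:ℝ) else 0) * x (Sum.inl i') =
        if (j : ℕ) = 0 then x (Sum.inl i) else 0 := by
      intro i j
      rw [Finset.sum_eq_single i]
      · simp
      · intro b _ hb
        simp [hb]
      · simp
    have k22 : ∀ (i : Fin 4) (j : Fin (t i)), ∑ i' : Fin 4, ∑ j' : Fin (t i'),
        (if i = i' then (if ((j' : ℕ) = j + 1 ∨ (j : ℕ) = j' + 1) then (1:ℝ) else 0) else 0)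
          * x (Sum.inr ⟨i', j'⟩) =
        ∑ j' : Fin (t i), if ((j' : ℕ) = j + 1 ∨ (j : ℕ) = j' + 1) then
          x (Sum.inr ⟨i, j'⟩) else 0 := by
      intro i j
      rw [Finset.sum_eq_single i]
      · simp
      · intro b _ hb
        simp [hb.symm]
      · simp
    simp only [k12, k21, k22, mul_add, Finset.sum_add_distrib, Finset.mul_sum, mul_ite, mul_zero]
    have k11 : ∑ i : Fin 4, ∑ i' : Fin 4, x (Sum.inl i) *
        ((if i' = i + 1 ∨ i = i' + 1 then (1:ℝ) else 0) * x (Sum.inl i')) =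
        2 * (x (Sum.inl 0) + x (Sum.inl 2)) * (x (Sum.inl 1) + x (Sum.inl 3)) := by
      have d : ∀ i i' : Fin 4, (if i' = i + 1 ∨ i = i' + 1 then (1:ℝ) else 0) =
          if (i.val + i'.val) % 2 = 1 then 1 else 0 := by
        intro i i'
        congr 1
        rw [eq_iff_iff]
        revert i i'; decide
      simp only [d, Fin.sum_univ_four]
      norm_num
      ring
    rw [k11]
    have k3 : ∀ i : Fin 4, ∀ j : Fin (t i),
      (if (j : ℕ) = 0 then 2 * (x (Sum.inl i) * x (Sum.inr ⟨i, j⟩)) else 0) =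
      (if (j : ℕ) = 0 then x (Sum.inl i) * x (Sum.inr ⟨i, j⟩) else 0) +
      (if (j : ℕ) = 0 then x (Sum.inr ⟨i, j⟩) * x (Sum.inl i) else 0) := by
      intro i j
      split_ifs <;> ring
    simp only [k3, Finset.sum_add_distrib]
    ring
  have e2 : x ⬝ᵥ x = ∑ i, (x (Sum.inl i) ^ 2 + ∑ j : Fin (t i), x (Sum.inr ⟨i, j⟩) ^ 2) := by
    simp only [dotProduct, Fintype.sum_sum_type, Fintype.sum_sigma, Finset.sum_add_distrib, sq]
  rw [e1, e2, hx, Finset.mul_sum]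
  simp only [mul_zero, zero_mul, zero_add]
  exact Finset.sum_le_sum fun i _ => hp i

lemma anti_symm {n : ℕ} (μ : Fin n → ℝ) (hm : Antitone μ)
    (h : ∀ x : ℝ, ∏ i, (x - μ i) = ∏ i, (x + μ i)) (i : Fin n) : μ i = - μ i.rev := by
  have hpoly : (∏ i, (Polynomial.X - Polynomial.C (μ i))) =
      ∏ i : Fin n, (Polynomial.X - Polynomial.C (-μ i.rev)) := by
    apply Polynomial.funext
    intro x
    have := Equiv.prod_comp Fin.revPerm (fun i => x + μ i)
    simp only [Fin.revPerm_apply] at this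
    simp [Polynomial.eval_prod, h x, this]
  have hr := congrArg Polynomial.roots hpoly
  rw [Finset.prod_eq_multiset_prod, Finset.prod_eq_multiset_prod,
    ← Function.comp_def (fun a => Polynomial.X - Polynomial.C a) μ, ← Multiset.map_map,
    ← Function.comp_def (fun a => Polynomial.X - Polynomial.C a) (fun i : Fin n => -μ i.rev),
    ← Multiset.map_map,
    Polynomial.roots_multiset_prod_X_sub_C, Polynomial.roots_multiset_prod_X_sub_C,
    Fin.univ_val_map, Fin.univ_val_map, Multiset.coe_eq_coe] at hr
  have h2 : Antitone (fun i : Fin n => -μ i.rev) := by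
    intro a b hab
    have := hm (Fin.rev_le_rev.2 hab)
    simpa using this
  exact congrFun (List.ofFn_injective (hr.eq_of_sortedGE hm.sortedGE_ofFn h2.sortedGE_ofFn)) i

lemma prod_symm {V : Type*} [Fintype V] [DecidableEq V] (A : Matrix V V ℝ) (s : V → ℝ)
    (hs : ∀ v, s v * s v = 1) (hA : ∀ u v, s u * A u v * s v = - A u v) {n : ℕ}
    (hn : Fintype.card V = n) (μ : Fin n → ℝ)
    (h : A.charpoly = ∏ i, (Polynomial.X - Polynomial.C (μ i))) (x : ℝ) :
    ∏ i, (x - μ i) = ∏ i, (x + μ i) := by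
  have key : ∀ x, (Matrix.scalar V x - A).det = ∏ i, (x - μ i) := by
    intro x
    rw [← Matrix.eval_charpoly, h]
    simp [Polynomial.eval_prod]
  have e1 : ∏ i, (x + μ i) = (Matrix.scalar V x + A).det := by
    have : Matrix.scalar V x + A = -(Matrix.scalar V (-x) - A) := by
      rw [map_neg]; abel
    rw [this, Matrix.det_neg, key, hn]
    have : ∀ i, x + μ i = -1 * (-x - μ i) := fun i => by ring
    simp_rw [this, Finset.prod_mul_distrib]
    simp
  have e2 : Matrix.scalar V x + A =
      Matrix.diagonal s * (Matrix.scalar V x - A) * Matrix.diagonal s := by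
    ext u v
    rw [Matrix.mul_diagonal, Matrix.diagonal_mul]
    have := hA u v
    simp only [Matrix.add_apply, Matrix.sub_apply, Matrix.scalar_apply, Matrix.diagonal_apply]
    split_ifs with huv
    · subst huv
      have := hs u
      linear_combination (-x) * this + hA u u
    · linear_combination hA u v
  have e3 : (Matrix.diagonal s).det * (Matrix.diagonal s).det = 1 := by
    rw [← Matrix.det_mul, Matrix.diagonal_mul_diagonal]
    simp [hs]
  rw [e1, e2, Matrix.det_mul, Matrix.det_mul, key]
  linear_combination (-∏ i, (x - μ i)) * e3

/-- A symmetric matrix whose form is at most `c` on a hyperplane has second eigenvalue `≤ c`. -/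
lemma second_le {V : Type*} [Fintype V] [DecidableEq V] (A : Matrix V V ℝ) (hA : A.IsHermitian)
    (f : (V → ℝ) →ₗ[ℝ] ℝ) (c : ℝ)
    (hf : ∀ x, f x = 0 → x ⬝ᵥ A.mulVec x ≤ c * (x ⬝ᵥ x)) {n : ℕ} (μ : Fin n → ℝ)
    (hm : Antitone μ)
    (h : A.charpoly = ∏ i, (Polynomial.X - Polynomial.C (μ i))) (a : Fin n) (ha : (a : ℕ) = 1) :
    μ a ≤ c := by
  by_contra! hc
  have hr : Multiset.map hA.eigenvalues Finset.univ.val = Multiset.map μ Finset.univ.val := by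
    have h1 := hA.roots_charpoly_eq_eigenvalues
    rw [h, Finset.prod_eq_multiset_prod,
      ← Function.comp_def (fun a => Polynomial.X - Polynomial.C a) μ, ← Multiset.map_map,
      Polynomial.roots_multiset_prod_X_sub_C] at h1
    exact h1.symm
  have hcard : (Finset.univ.filter (fun v => c < hA.eigenvalues v)).card =
      (Finset.univ.filter (fun i => c < μ i)).card := by
    have := congrArg (Multiset.countP (fun y => c < y)) hr
    rw [Multiset.countP_map, Multiset.countP_map] at this
    exact this
  have h2 : 1 < (Finset.univ.filter (fun i => c < μ i)).card := by
    rw [Finset.one_lt_card]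
    have hn : 0 < n := a.pos
    refine ⟨⟨0, hn⟩, ?_, a, by simpa using hc, ?_⟩
    · simp only [Finset.mem_filter, Finset.mem_univ, true_and]
      exact hc.trans_le (hm (Fin.le_def.2 (Nat.zero_le _)))
    · intro h'
      rw [← h'] at ha
      simp at ha
  rw [← hcard, Finset.one_lt_card] at h2
  obtain ⟨u, hu, v, hv, huv⟩ := h2
  simp only [Finset.mem_filter, Finset.mem_univ, true_and] at hu hv
  set p : V → ℝ := ⇑(hA.eigenvectorBasis u) with hp
  set q : V → ℝ := ⇑(hA.eigenvectorBasis v) with hq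
  have hAp : A.mulVec p = hA.eigenvalues u • p := hA.mulVec_eigenvectorBasis u
  have hAq : A.mulVec q = hA.eigenvalues v • q := hA.mulVec_eigenvectorBasis v
  have ho := hA.eigenvectorBasis.orthonormal
  rw [orthonormal_iff_ite] at ho
  have hpp : p ⬝ᵥ p = 1 := by
    have := ho u u
    rw [EuclideanSpace.inner_eq_star_dotProduct] at this
    simpa only [star_trivial, if_true] using this
  have hqq : q ⬝ᵥ q = 1 := by
    have := ho v v
    rw [EuclideanSpace.inner_eq_star_dotProduct] at this
    simpa only [star_trivial, if_true] using this
  have hqp : q ⬝ᵥ p = 0 := by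
    have := ho u v
    rw [EuclideanSpace.inner_eq_star_dotProduct] at this
    simpa only [star_trivial, if_neg huv] using this
  have hpq : p ⬝ᵥ q = 0 := by rw [dotProduct_comm, hqp]
  have main : ∀ α β : ℝ, f (α • p + β • q) = 0 → α ^ 2 + β ^ 2 ≤ 0 := by
    intro α β h0
    have := hf _ h0
    simp only [Matrix.mulVec_add, Matrix.mulVec_smul, hAp, hAq, add_dotProduct, dotProduct_add,
      smul_dotProduct, dotProduct_smul, hpp, hqq, hpq, hqp, smul_eq_mul] at this
    by_contra! hpos
    rcases eq_or_ne α 0 with h1 | h1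
    · subst h1
      have : 0 < β ^ 2 * (hA.eigenvalues v - c) := mul_pos (by linarith) (by linarith)
      nlinarith
    · have h3 : 0 < α ^ 2 * (hA.eigenvalues u - c) := mul_pos (by positivity) (by linarith)
      have h4 : 0 ≤ β ^ 2 * (hA.eigenvalues v - c) := mul_nonneg (by positivity) (by linarith)
      nlinarith
  by_cases hfp : f p = 0
  · have := main 1 0 (by simp [hfp])
    norm_num at this
  · have := main (f q) (-f p) (by simp; ring)
    have : 0 < f p ^ 2 := by positivity
    nlinarith [sq_nonneg (f q)]

/-- For `G = C₄(t₁,t₂,t₃,t₄)` with `0 ≤ tᵢ ≤ 2`, the second largest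
eigenvalue `λ₂(G)` (0-indexed position 1) satisfies `λ₂(G) ≤ √2`, the second
smallest eigenvalue `λ₂⁻(G)` (0-indexed position `n-2`) satisfies `λ₂⁻(G) ≥ -√2`,
and moreover `λ₂(G) = -λ₂⁻(G)`. -/
theorem cycleFourPendant_second_eigenvalues
    (t : Fin 4 → ℕ) (ht : ∀ i, t i ≤ 2)
    (μ : Fin (Fintype.card ((Fin 4) ⊕ (Σ i : Fin 4, Fin (t i)))) → ℝ)
    (hμ : (cycleFourPendant t).IsEigenvalueSeq μ)
    (a b : Fin (Fintype.card ((Fin 4) ⊕ (Σ i : Fin 4, Fin (t i)))))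
    (ha : (a : ℕ) = 1)
    (hb : (b : ℕ) = Fintype.card ((Fin 4) ⊕ (Σ i : Fin 4, Fin (t i))) - 2) :
    μ a ≤ Real.sqrt 2 ∧ -Real.sqrt 2 ≤ μ b ∧ μ a = -μ b := by
  classical
  obtain ⟨hm, hc⟩ := hμ
  have hcard : 4 ≤ Fintype.card ((Fin 4) ⊕ (Σ i : Fin 4, Fin (t i))) := by
    rw [Fintype.card_sum, Fintype.card_fin]; omega
  have hsym : ∀ i, μ i = - μ i.rev := by
    apply anti_symm μ hm
    refine prod_symm _ (fun v => match v with
      | Sum.inl i => (-1) ^ (i : ℕ)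
      | Sum.inr ⟨i, j⟩ => (-1) ^ ((i : ℕ) + j + 1)) ?_ ?_ rfl μ hc
    · rintro (i | ⟨i, j⟩) <;> simp [← mul_pow]
    · rintro (i | ⟨i, j⟩) (i' | ⟨i', j'⟩)
      · simp only [SimpleGraph.adjMatrix_apply, adj11]
        split_ifs with h
        · have hodd : ∀ i i' : Fin 4, (i' = i + 1 ∨ i = i' + 1) → (i.val + i'.val) % 2 = 1 := by
            decide
          rw [mul_one, ← pow_add]
          exact Odd.neg_one_pow (Nat.odd_iff.2 (hodd i i' h))
        · simp
      · simp only [SimpleGraph.adjMatrix_apply, adj12]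
        split_ifs with h
        · obtain ⟨rfl, h⟩ := h
          rw [h, mul_one, ← pow_add]
          exact Odd.neg_one_pow ⟨i, by ring⟩
        · simp
      · simp only [SimpleGraph.adjMatrix_apply, adj21]
        split_ifs with h
        · obtain ⟨rfl, h⟩ := h
          rw [h, mul_one, ← pow_add]
          exact Odd.neg_one_pow ⟨i', by ring⟩
        · simp
      · simp only [SimpleGraph.adjMatrix_apply, adj22]
        split_ifs with h
        · obtain ⟨rfl, h | h⟩ := h
          · rw [h, mul_one, ← pow_add]
            exact Odd.neg_one_pow ⟨i + j + 1, by ring⟩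
          · rw [h, mul_one, ← pow_add]
            exact Odd.neg_one_pow ⟨i + j' + 1, by ring⟩
        · simp
  have hab : μ a = - μ b := by
    have : b = a.rev := by
      ext
      rw [hb, Fin.val_rev, ha]
    rw [this]
    exact hsym a
  have hle : μ a ≤ Real.sqrt 2 := by
    let : DecidableRel (cycleFourPendant t).Adj := Classical.decRel _
    refine second_le ((cycleFourPendant t).adjMatrix ℝ) ?_
      { toFun := fun x => x (Sum.inl 0) + x (Sum.inl 2)
        map_add' := fun x y => by simp only [Pi.add_apply]; ring
        map_smul' := fun r x => by
          simp only [Pi.smul_apply, smul_eq_mul, RingHom.id_apply]; ring } _ ?_ μ hm hc a ha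
    · exact (SimpleGraph.isSymm_adjMatrix _)
    · intro x hx
      exact quad_form t ht x hx
  exact ⟨hle, by linarith, hab⟩
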